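/- Let d ≥ 1, and adopt the stochastic Fourier advection–diffusion setup with diffusivity ν ∈ (0, e^{−1}], initial data g, mixing constants K ≥ 1, γ > 0, and asymptotic mass measure m. Suppose in addition there are a real q ≥ 2 and a deterministic constant D ≥ 1 such that almost surely, for all t ≥ 0, Σ_{k∈ℤ^d} (1+|k|)^q |v_t(k)| ≤ D. Then there is a constant C ≥ 2, depending only on d, K, γ, and N₀, such that for every h ≥ 1 and every R with max(C, h) ≤ R ≤ ν^{−1/2} / (C (log ν^{−1})^{1/2}): μ_{N₀,R}( { r ∈ [h, R] : m([r, r+h]) ≤ h / (C D r) } ) ≤ C^q h^{2−q} D. -/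

import Mathlib

open MeasureTheory ENNReal Real Set
open scoped Classical

noncomputable section

/-- Euclidean norm of a lattice point `k ∈ ℤ^d`. -/
def znorm {d : ℕ} (k : Fin d → ℤ) : ℝ := Real.sqrt (∑ i, ((k i : ℝ)) ^ 2)

/-- Euclidean norm of a vector in `ℂ^d`. -/
def cnorm {d : ℕ} (z : Fin d → ℂ) : ℝ := Real.sqrt (∑ i, ‖z i‖ ^ 2)

/-- Pairing `k · z = Σ_i k_i z_i`. -/
def zdot {d : ℕ} (k : Fin d → ℤ) (z : Fin d → ℂ) : ℂ := ∑ i, (k i : ℂ) * z i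

/-- Divergence-free in Fourier variables: `k · v(k) = 0` for all `k`. -/
def DivFree {d : ℕ} (v : (Fin d → ℤ) → Fin d → ℂ) : Prop := ∀ k, zdot k (v k) = 0

/-- Fourier coefficients of a real vector field: `v(-k) = conj (v k)`. -/
def RealCoeff {d : ℕ} (v : (Fin d → ℤ) → Fin d → ℂ) : Prop :=
  ∀ k i, v (-k) i = starRingEnd ℂ (v k i)

/-- A weight: nondecreasing on `[0,∞)` with values in `[1,∞]`. -/
def IsWeight (w : ℝ → ℝ≥0∞) : Prop :=
  MonotoneOn w (Set.Ici 0) ∧ ∀ s, 0 ≤ s → 1 ≤ w s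

/-- Weighted ℓ¹ norm `‖w v‖_{ℓ¹} = Σ_k w(|k|)|v(k)|`. -/
def wl1 {d : ℕ} (w : ℝ → ℝ≥0∞) (v : (Fin d → ℤ) → Fin d → ℂ) : ℝ≥0∞ :=
  ∑' k, w (znorm k) * ENNReal.ofReal (cnorm (v k))

/-- `(w⁻¹ * m_a)(r) = Σ_k w(||k|-r|)⁻¹ |a(k)|²`. -/
def convMass {d : ℕ} (w : ℝ → ℝ≥0∞) (a : (Fin d → ℤ) → ℂ) (r : ℝ) : ℝ≥0∞ :=
  ∑' k, (w |znorm k - r|)⁻¹ * (‖a k‖₊ : ℝ≥0∞) ^ 2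

/-- `m_a(E) = Σ_{|k| ∈ E} |a(k)|²`. -/
def massOn {d : ℕ} (a : (Fin d → ℤ) → ℂ) (E : Set ℝ) : ℝ≥0∞ :=
  ∑' k, if znorm k ∈ E then (‖a k‖₊ : ℝ≥0∞) ^ 2 else 0

/-- Logarithmic density measure `μ_{a,b}(E)`. -/
def logDensity (a b : ℝ) (E : Set ℝ) : ℝ≥0∞ :=
  (ENNReal.ofReal (Real.log (b / a)))⁻¹ * ∫⁻ r in E ∩ Set.Icc a b, ENNReal.ofReal r⁻¹

/-- The right-hand side of the Fourier advection–diffusion system. -/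
def fourierRHS {d : ℕ} (ν : ℝ) (v : (Fin d → ℤ) → Fin d → ℂ) (a : (Fin d → ℤ) → ℂ)
    (k : Fin d → ℤ) : ℂ :=
  Complex.ofReal (-(4 * π ^ 2 * ν * znorm k ^ 2)) * a k
    - 2 * Complex.ofReal π * Complex.I * ∑' j, zdot k (v (k - j)) * a j


/-- The asymptotic mass measure `m(E) = 𝔼 ∫_0^∞ m_{a_t}(E) dt`. -/
def asymMass {d : ℕ} {Ω : Type*} [MeasurableSpace Ω] (ℙ : Measure Ω)
    (a : Ω → ℝ → (Fin d → ℤ) → ℂ) (E : Set ℝ) : ℝ≥0∞ :=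
  ∫⁻ ω, (∫⁻ t in Set.Ici (0 : ℝ), massOn (a ω t) E) ∂ℙ

/-- The stochastic Fourier advection–diffusion setup: measurability, a divergence-free
real velocity, initial data `g` of unit mass and zero mean, the Fourier-coefficient
advection–diffusion ODE, rapid decrease locally uniformly in time, and the
uniform-in-diffusivity exponential mixing bound. -/
def AdvectionSetup {d : ℕ} {Ω : Type*} [MeasurableSpace Ω] (ℙ : Measure Ω) (ν K γ : ℝ)
    (v : Ω → ℝ → (Fin d → ℤ) → Fin d → ℂ) (a : Ω → ℝ → (Fin d → ℤ) → ℂ)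
    (g : (Fin d → ℤ) → ℂ) : Prop :=
  (∀ k : Fin d → ℤ, Measurable fun p : Ω × ℝ => a p.1 p.2 k) ∧
  (∀ (k : Fin d → ℤ) (i : Fin d), Measurable fun p : Ω × ℝ => v p.1 p.2 k i) ∧
  g 0 = 0 ∧
  (∑' k : Fin d → ℤ, (‖g k‖₊ : ℝ≥0∞) ^ 2) = 1 ∧
  (∀ᵐ ω ∂ℙ,
    (∀ t : ℝ, 0 ≤ t → DivFree (v ω t) ∧ RealCoeff (v ω t)) ∧
    a ω 0 = g ∧
    (∀ (k : Fin d → ℤ), ∀ t ∈ Set.Ici (0 : ℝ),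
      HasDerivWithinAt (fun s => a ω s k) (fourierRHS ν (v ω t) (a ω t) k) (Set.Ici 0) t) ∧
    (∀ N : ℕ, ∀ T > (0 : ℝ), ∃ M : ℝ, ∀ t ∈ Set.Icc (0 : ℝ) T,
      ∑' k : Fin d → ℤ, ENNReal.ofReal ((1 + znorm k) ^ N) * (‖a ω t k‖₊ : ℝ≥0∞) ^ 2
        ≤ ENNReal.ofReal M)) ∧
  (∀ t : ℝ, 0 ≤ t →
    (∫⁻ ω, (∑' k : Fin d → ℤ, if k = 0 then 0 else
        (ENNReal.ofReal ((2 * π * znorm k) ^ 2))⁻¹ * (‖a ω t k‖₊ : ℝ≥0∞) ^ 2) ∂ℙ)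
      ≤ ENNReal.ofReal (K * Real.exp (-γ * t)))

/-! ### Lattice norms -/

lemma znorm_eq_norm {d : ℕ} (k : Fin d → ℤ) :
    znorm k = ‖(WithLp.toLp 2 (fun i => (k i : ℝ)) : EuclideanSpace ℝ (Fin d))‖ := by
  simp [znorm, EuclideanSpace.norm_eq]

lemma znorm_nonneg {d : ℕ} (k : Fin d → ℤ) : 0 ≤ znorm k := Real.sqrt_nonneg _

lemma cnorm_nonneg {d : ℕ} (z : Fin d → ℂ) : 0 ≤ cnorm z := Real.sqrt_nonneg _

lemma znorm_zero {d : ℕ} : znorm (0 : Fin d → ℤ) = 0 := by simp [znorm]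

lemma znorm_le_add_sub {d : ℕ} (k j : Fin d → ℤ) : znorm j ≤ znorm k + znorm (k - j) := by
  simp only [znorm_eq_norm]
  have h : (WithLp.toLp 2 (fun i => (j i : ℝ)) : EuclideanSpace ℝ (Fin d))
      = WithLp.toLp 2 (fun i => (k i : ℝ)) - WithLp.toLp 2 (fun i => ((k - j) i : ℝ)) := by
    ext i
    simp
  rw [h]
  exact norm_sub_le _ _

lemma abs_apply_le_znorm {d : ℕ} (k : Fin d → ℤ) (i : Fin d) : |(k i : ℝ)| ≤ znorm k := by
  unfold znorm
  apply Real.abs_le_sqrt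
  exact Finset.single_le_sum (f := fun i => (k i : ℝ) ^ 2) (fun _ _ => sq_nonneg _)
    (Finset.mem_univ i)

lemma one_le_znorm {d : ℕ} {k : Fin d → ℤ} (hk : k ≠ 0) : 1 ≤ znorm k := by
  obtain ⟨i, hi⟩ := Function.ne_iff.mp hk
  refine le_trans ?_ (abs_apply_le_znorm k i)
  exact_mod_cast Int.one_le_abs hi

lemma finite_znorm_lt (d : ℕ) (r : ℝ) : {k : Fin d → ℤ | znorm k < r}.Finite := by
  refine (Set.Finite.pi' (t := fun _ : Fin d => Set.Icc (-⌈r⌉) ⌈r⌉)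
    fun _ => Set.finite_Icc _ _).subset ?_
  intro k hk i
  have h : |(k i : ℝ)| ≤ (⌈r⌉ : ℤ) :=
    (abs_apply_le_znorm k i).trans (hk.le.trans (Int.le_ceil r))
  rw [abs_le] at h
  exact ⟨by exact_mod_cast h.1, by exact_mod_cast h.2⟩

/-- The finite set of lattice points in the open ball of radius `r`. -/
def latticeBall (d : ℕ) (r : ℝ) : Finset (Fin d → ℤ) := (finite_znorm_lt d r).toFinset

lemma mem_latticeBall {d : ℕ} {r : ℝ} {k : Fin d → ℤ} : k ∈ latticeBall d r ↔ znorm k < r := by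
  simp [latticeBall]

lemma norm_zdot_le {d : ℕ} (k : Fin d → ℤ) (z : Fin d → ℂ) :
    ‖zdot k z‖ ≤ znorm k * cnorm z := by
  unfold zdot
  refine (norm_sum_le _ _).trans ?_
  have h := Real.sum_mul_le_sqrt_mul_sqrt Finset.univ (fun i => |(k i : ℝ)|) (fun i => ‖z i‖)
  simp only [sq_abs] at h
  refine le_trans (le_of_eq ?_) h
  refine Finset.sum_congr rfl fun i _ => ?_
  rw [norm_mul, Complex.norm_intCast]

/-! ### The polynomial weight -/

/-- The weight `s ↦ (1 + s) ^ q`. -/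
def polyWeight (q s : ℝ) : ℝ≥0∞ := ENNReal.ofReal ((1 + s) ^ q)

lemma one_le_polyWeight {q s : ℝ} (hq : 0 ≤ q) (hs : 0 ≤ s) : 1 ≤ polyWeight q s := by
  rw [polyWeight, ENNReal.one_le_ofReal]
  exact Real.one_le_rpow (by linarith) hq

lemma polyWeight_mono {q s t : ℝ} (hq : 0 ≤ q) (hs : 0 ≤ s) (hst : s ≤ t) :
    polyWeight q s ≤ polyWeight q t :=
  ENNReal.ofReal_le_ofReal (Real.rpow_le_rpow (by linarith) (by linarith) hq)

lemma convMass_polyWeight_le {d : ℕ} {q : ℝ} (hq : 0 ≤ q) (a : (Fin d → ℤ) → ℂ) (r : ℝ) :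
    convMass (polyWeight q) a r ≤ ∑' k, (‖a k‖₊ : ℝ≥0∞) ^ 2 := by
  refine ENNReal.tsum_le_tsum fun k => ?_
  refine mul_le_of_le_one_left' ?_
  rw [ENNReal.inv_le_one]
  exact one_le_polyWeight hq (abs_nonneg _)

lemma polyWeight_crossing {d : ℕ} {q r : ℝ} (hq : 0 ≤ q) {k j : Fin d → ℤ} (z : Fin d → ℂ)
    (hk : znorm k < r) (hj : r ≤ znorm j) :
    ENNReal.ofReal (cnorm z) ≤
        polyWeight q (znorm (k - j)) * ENNReal.ofReal (cnorm z) * (polyWeight q |znorm k - r|)⁻¹ ∧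
    ENNReal.ofReal (cnorm z) ≤
        polyWeight q (znorm (k - j)) * ENNReal.ofReal (cnorm z)
          * (polyWeight q |znorm j - r|)⁻¹ := by
  have key : ∀ s, 0 ≤ s → s ≤ znorm (k - j) → ENNReal.ofReal (cnorm z) ≤
      polyWeight q (znorm (k - j)) * ENNReal.ofReal (cnorm z) * (polyWeight q s)⁻¹ := by
    intro s hs hle
    have h1 : polyWeight q s ≠ 0 := (lt_of_lt_of_le one_pos (one_le_polyWeight hq hs)).ne'
    have h2 : polyWeight q s ≠ ⊤ := ENNReal.ofReal_ne_top
    calc ENNReal.ofReal (cnorm z)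
        = polyWeight q s * ENNReal.ofReal (cnorm z) * (polyWeight q s)⁻¹ := by
          rw [mul_right_comm, ENNReal.mul_inv_cancel h1 h2, one_mul]
      _ ≤ _ := by gcongr; exact polyWeight_mono hq hs hle
  have ht := znorm_le_add_sub k j
  refine ⟨key _ (abs_nonneg _) ?_, key _ (abs_nonneg _) ?_⟩
  · rw [abs_of_nonpos (by linarith)]; linarith
  · rw [abs_of_nonneg (by linarith)]; linarith

lemma ENNReal.mul_le_sq_add_sq (x y : ℝ≥0∞) : x * y ≤ x ^ 2 + y ^ 2 := by
  rcases le_total x y with h | h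
  · calc x * y ≤ y * y := by gcongr
      _ = y ^ 2 := (sq y).symm
      _ ≤ _ := le_add_self
  · calc x * y ≤ x * x := by gcongr
      _ = x ^ 2 := (sq x).symm
      _ ≤ _ := le_self_add

/-! ### The energy flux through a sphere -/

/-- The absolute flux through the sphere of radius `r` is controlled by the mass near it. -/
lemma crossing_sum_le {d : ℕ} {q D r : ℝ} (hq : 0 ≤ q) (v : (Fin d → ℤ) → Fin d → ℂ)
    (a : (Fin d → ℤ) → ℂ)
    (hv : ∑' k, ENNReal.ofReal ((1 + znorm k) ^ q * cnorm (v k)) ≤ ENNReal.ofReal D) :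
    ∑ k ∈ latticeBall d r, ∑' j, (if j ∈ latticeBall d r then 0 else
        ENNReal.ofReal (cnorm (v (k - j))) * (‖a k‖ₑ * ‖a j‖ₑ))
      ≤ 2 * ENNReal.ofReal D * convMass (polyWeight q) a r := by
  set V : (Fin d → ℤ) → ℝ≥0∞ := fun l => polyWeight q (znorm l) * ENNReal.ofReal (cnorm (v l))
    with hV
  set W : (Fin d → ℤ) → ℝ≥0∞ := fun k => (polyWeight q |znorm k - r|)⁻¹ * ‖a k‖ₑ ^ 2 with hW
  have hWF : convMass (polyWeight q) a r = ∑' k, W k := rfl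
  have hVD : ∑' l, V l ≤ ENNReal.ofReal D := by
    refine le_trans (le_of_eq ?_) hv
    refine tsum_congr fun k => ?_
    have := znorm_nonneg k
    exact (ENNReal.ofReal_mul (by positivity)).symm
  have hterm : ∀ k ∈ latticeBall d r, ∀ j, (if j ∈ latticeBall d r then 0 else
      ENNReal.ofReal (cnorm (v (k - j))) * (‖a k‖ₑ * ‖a j‖ₑ))
        ≤ V (k - j) * W k + V (k - j) * W j := by
    intro k hk j
    split_ifs with hj
    · exact zero_le
    · rw [mem_latticeBall] at hk hj
      obtain ⟨h1, h2⟩ := polyWeight_crossing hq (v (k - j)) hk (not_lt.mp hj)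
      calc _ ≤ ENNReal.ofReal (cnorm (v (k - j))) * (‖a k‖ₑ ^ 2 + ‖a j‖ₑ ^ 2) := by
            gcongr; exact ENNReal.mul_le_sq_add_sq _ _
        _ = ENNReal.ofReal (cnorm (v (k - j))) * ‖a k‖ₑ ^ 2
            + ENNReal.ofReal (cnorm (v (k - j))) * ‖a j‖ₑ ^ 2 := mul_add _ _ _
        _ ≤ (V (k - j) * (polyWeight q |znorm k - r|)⁻¹) * ‖a k‖ₑ ^ 2
            + (V (k - j) * (polyWeight q |znorm j - r|)⁻¹) * ‖a j‖ₑ ^ 2 := by gcongr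
        _ = _ := by rw [hW]; ring
  calc _ ≤ ∑ k ∈ latticeBall d r, ∑' j, (V (k - j) * W k + V (k - j) * W j) :=
        Finset.sum_le_sum fun k hk => ENNReal.tsum_le_tsum fun j => hterm k hk j
    _ ≤ ∑' k, ∑' j, (V (k - j) * W k + V (k - j) * W j) := ENNReal.sum_le_tsum _
    _ = ∑' k, ∑' j, V (k - j) * W k + ∑' k, ∑' j, V (k - j) * W j := by
        simp_rw [ENNReal.tsum_add]
    _ = ∑' k, (∑' l, V l) * W k + ∑' j, (∑' l, V l) * W j := by
        congr 1
        · refine tsum_congr fun k => ?_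
          rw [ENNReal.tsum_mul_right, ← Equiv.tsum_eq (Equiv.subLeft k) V]
          rfl
        · rw [ENNReal.tsum_comm]
          refine tsum_congr fun j => ?_
          rw [ENNReal.tsum_mul_right, ← Equiv.tsum_eq (Equiv.subRight j) V]
          rfl
    _ = 2 * (∑' l, V l) * ∑' k, W k := by
        rw [ENNReal.tsum_mul_left]; ring
    _ ≤ _ := by rw [hWF]; gcongr

lemma summable_advection {d : ℕ} {q D : ℝ} (hq : 0 ≤ q) (v : (Fin d → ℤ) → Fin d → ℂ)
    (a : (Fin d → ℤ) → ℂ)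
    (hv : ∑' k, ENNReal.ofReal ((1 + znorm k) ^ q * cnorm (v k)) ≤ ENNReal.ofReal D)
    (ha : ∑' k, (‖a k‖₊ : ℝ≥0∞) ^ 2 ≠ ⊤) (k : Fin d → ℤ) :
    Summable fun j => zdot k (v (k - j)) * a j := by
  have hsv : Summable fun l => cnorm (v l) := by
    have h1 : ∑' l, ENNReal.ofReal (cnorm (v l)) ≠ ⊤ := by
      refine ne_top_of_le_ne_top ENNReal.ofReal_ne_top (le_trans ?_ hv)
      refine ENNReal.tsum_le_tsum fun l => ENNReal.ofReal_le_ofReal ?_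
      exact le_mul_of_one_le_left (cnorm_nonneg _)
        (Real.one_le_rpow (by linarith [znorm_nonneg l]) hq)
    refine (ENNReal.summable_toReal h1).congr fun l => ?_
    rw [ENNReal.toReal_ofReal (cnorm_nonneg _)]
  have hsv' : Summable fun j => cnorm (v (k - j)) := 
    hsv.comp_injective (i := fun j => k - j) sub_right_injective
  obtain ⟨B, hB⟩ : ∃ B : ℝ, ∀ j, ‖a j‖ ≤ B := by
    have h2 := ENNReal.summable_toReal ha
    simp only [ENNReal.toReal_pow, ENNReal.coe_toReal, coe_nnnorm] at h2
    refine ⟨1 + ∑' j, ‖a j‖ ^ 2, fun j => ?_⟩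
    have h3 : ‖a j‖ ^ 2 ≤ ∑' j, ‖a j‖ ^ 2 := h2.le_tsum j fun _ _ => sq_nonneg _
    nlinarith [sq_nonneg (‖a j‖ - 1)]
  refine Summable.of_norm_bounded ((hsv'.mul_left (znorm k)).mul_right B) fun j => ?_
  rw [norm_mul]
  exact mul_le_mul (norm_zdot_le _ _) (hB j) (norm_nonneg _)
    (mul_nonneg (znorm_nonneg _) (cnorm_nonneg _))

lemma zdot_hermitian {d : ℕ} {v : (Fin d → ℤ) → Fin d → ℂ} (hdiv : DivFree v)
    (hreal : RealCoeff v) (k j : Fin d → ℤ) :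
    starRingEnd ℂ (zdot j (v (j - k))) = zdot k (v (k - j)) := by
  have h1 : starRingEnd ℂ (zdot j (v (j - k))) = zdot j (v (k - j)) := by
    simp only [zdot, map_sum, map_mul]
    refine Finset.sum_congr rfl fun i _ => ?_
    rw [← hreal, neg_sub]
    simp
  have h2 := hdiv (k - j)
  rw [h1]
  simp only [zdot, Pi.sub_apply, Int.cast_sub, sub_mul, Finset.sum_sub_distrib] at h2 ⊢
  exact (sub_eq_zero.mp h2).symm

lemma inner_mul_neg_two_pi_I (x y : ℂ) :
    inner ℝ x (2 * Complex.ofReal π * Complex.I * y)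
      = -(2 * π * (starRingEnd ℂ x * y).im) := by
  simp [Complex.inner, Complex.mul_re, Complex.mul_im]
  ring

/-- The time derivative of the energy in the ball of radius `r` differs from the dissipation by
at most the flux through the sphere. -/
lemma abs_energy_rate_le {d : ℕ} {ν q D r : ℝ} (hq : 0 ≤ q) (hD : 0 ≤ D)
    (hr : 0 ≤ r) (v : (Fin d → ℤ) → Fin d → ℂ) (a : (Fin d → ℤ) → ℂ)
    (hdiv : DivFree v) (hreal : RealCoeff v)
    (hv : ∑' k, ENNReal.ofReal ((1 + znorm k) ^ q * cnorm (v k)) ≤ ENNReal.ofReal D)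
    (ha : ∑' k, (‖a k‖₊ : ℝ≥0∞) ^ 2 ≠ ⊤) :
    |∑ k ∈ latticeBall d r, 2 * inner ℝ (a k) (fourierRHS ν v a k)
        + 8 * π ^ 2 * ν * ∑ k ∈ latticeBall d r, znorm k ^ 2 * ‖a k‖ ^ 2|
      ≤ 8 * π * r * D * (convMass (polyWeight q) a r).toReal := by
  set S := latticeBall d r with hS
  set Y : ℂ := ∑ k ∈ S, starRingEnd ℂ (a k) *
    ∑' j, (if j ∈ S then 0 else zdot k (v (k - j)) * a j) with hY
  set X : ℂ := ∑ k ∈ S, starRingEnd ℂ (a k) * ∑ j ∈ S, zdot k (v (k - j)) * a j with hX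
  have hsplit : ∀ k, ∑' j, zdot k (v (k - j)) * a j = ∑ j ∈ S, zdot k (v (k - j)) * a j
      + ∑' j, (if j ∈ S then 0 else zdot k (v (k - j)) * a j) := by
    intro k
    have hs := summable_advection hq v a hv ha k
    rw [← hs.sum_add_tsum_compl (s := S)]
    congr 1
    refine (tsum_subtype ((S : Set (Fin d → ℤ))ᶜ) fun j => zdot k (v (k - j)) * a j).trans ?_
    refine tsum_congr fun j => ?_
    by_cases hj : j ∈ S <;> simp [hj, Set.indicator]
  have hXim : X.im = 0 := by
    rw [← Complex.conj_eq_iff_im]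
    simp only [hX, Finset.mul_sum, map_sum, map_mul, Complex.conj_conj]
    rw [Finset.sum_comm]
    refine Finset.sum_congr rfl fun k _ => Finset.sum_congr rfl fun j _ => ?_
    rw [zdot_hermitian hdiv hreal]
    ring
  have hterm : ∀ k, 2 * inner ℝ (a k) (fourierRHS ν v a k)
      = -(8 * π ^ 2 * ν * (znorm k ^ 2 * ‖a k‖ ^ 2)) + 4 * π *
        (starRingEnd ℂ (a k) * ∑' j, zdot k (v (k - j)) * a j).im := by
    intro k
    rw [fourierRHS, inner_sub_right, inner_mul_neg_two_pi_I]
    have : inner ℝ (a k) (Complex.ofReal (-(4 * π ^ 2 * ν * znorm k ^ 2)) * a k)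
        = -(4 * π ^ 2 * ν * znorm k ^ 2) * ‖a k‖ ^ 2 := by
      rw [← Complex.real_smul, real_inner_smul_right, real_inner_self_eq_norm_sq]
    rw [this]
    ring
  have hsum : ∑ k ∈ S, 2 * inner ℝ (a k) (fourierRHS ν v a k)
      + 8 * π ^ 2 * ν * ∑ k ∈ S, znorm k ^ 2 * ‖a k‖ ^ 2 = 4 * π * Y.im := by
    have h2 : (∑ k ∈ S, starRingEnd ℂ (a k) * ∑' j, zdot k (v (k - j)) * a j) = X + Y := by
      rw [hX, hY, ← Finset.sum_add_distrib]
      refine Finset.sum_congr rfl fun k _ => ?_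
      rw [hsplit, mul_add]
    have h3 : ∑ k ∈ S, (starRingEnd ℂ (a k) * ∑' j, zdot k (v (k - j)) * a j).im = Y.im := by
      rw [← Complex.im_sum, h2, Complex.add_im, hXim, zero_add]
    simp_rw [hterm]
    rw [Finset.sum_add_distrib, ← Finset.mul_sum, h3, Finset.sum_neg_distrib, ← Finset.mul_sum]
    ring
  have hYe : ‖Y‖ₑ ≤ ENNReal.ofReal r *
      (2 * ENNReal.ofReal D * convMass (polyWeight q) a r) := by
    calc ‖Y‖ₑ ≤ ∑ k ∈ S, ‖starRingEnd ℂ (a k) *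
          ∑' j, (if j ∈ S then 0 else zdot k (v (k - j)) * a j)‖ₑ := enorm_sum_le _ _
      _ ≤ ∑ k ∈ S, ENNReal.ofReal r * ∑' j, (if j ∈ S then 0 else
          ENNReal.ofReal (cnorm (v (k - j))) * (‖a k‖ₑ * ‖a j‖ₑ)) := by
          refine Finset.sum_le_sum fun k hk => ?_
          rw [enorm_mul, RCLike.enorm_conj]
          refine (mul_le_mul_right enorm_tsum_le_tsum_enorm _).trans ?_
          rw [← ENNReal.tsum_mul_left, ← ENNReal.tsum_mul_left]
          refine ENNReal.tsum_le_tsum fun j => ?_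
          split_ifs with hj
          · simp
          · have h1 : ‖zdot k (v (k - j))‖ₑ
                ≤ ENNReal.ofReal r * ENNReal.ofReal (cnorm (v (k - j))) := by
              rw [← ENNReal.ofReal_mul hr, ← ofReal_norm]
              refine ENNReal.ofReal_le_ofReal ((norm_zdot_le _ _).trans ?_)
              exact mul_le_mul_of_nonneg_right (mem_latticeBall.mp hk).le (cnorm_nonneg _)
            rw [enorm_mul]
            calc ‖a k‖ₑ * (‖zdot k (v (k - j))‖ₑ * ‖a j‖ₑ)
                ≤ ‖a k‖ₑ * ((ENNReal.ofReal r * ENNReal.ofReal (cnorm (v (k - j)))) * ‖a j‖ₑ) := by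
                  gcongr
              _ = _ := by ring
      _ ≤ _ := by
          rw [← Finset.mul_sum]
          gcongr
          exact crossing_sum_le hq v a hv
  have hF : convMass (polyWeight q) a r ≠ ⊤ :=
    ne_top_of_le_ne_top ha (convMass_polyWeight_le hq a r)
  have hYn : ‖Y‖ ≤ r * (2 * D * (convMass (polyWeight q) a r).toReal) := by
    have := ENNReal.toReal_mono (by finiteness) hYe
    simpa [ENNReal.toReal_mul, ENNReal.toReal_ofReal hr, ENNReal.toReal_ofReal hD] using this
  rw [hsum, abs_mul, abs_of_pos (by positivity)]
  calc 4 * π * |Y.im| ≤ 4 * π * (r * (2 * D * (convMass (polyWeight q) a r).toReal)) := by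
        gcongr
        exact (Complex.abs_im_le_norm Y).trans hYn
    _ = _ := by ring

/-! ### Energy along a single trajectory -/

lemma polyWeight_inv {q s : ℝ} (hs : 0 ≤ s) :
    (polyWeight q s)⁻¹ = ENNReal.ofReal (((1 + s) ^ q)⁻¹) := by
  rw [polyWeight, ENNReal.ofReal_inv_of_pos (by positivity)]

lemma convMass_polyWeight_le_of_moment {d : ℕ} {q r M : ℝ} (hq : 2 ≤ q) (hr : 0 ≤ r)
    (a : (Fin d → ℤ) → ℂ)
    (ha : ∑' k : Fin d → ℤ, ENNReal.ofReal ((1 + znorm k) ^ 2) * (‖a k‖₊ : ℝ≥0∞) ^ 2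
      ≤ ENNReal.ofReal M) :
    convMass (polyWeight q) a r ≤ ENNReal.ofReal (((1 + r) ^ 2)⁻¹) * ENNReal.ofReal M := by
  refine le_trans ?_ (mul_le_mul_right ha _)
  rw [← ENNReal.tsum_mul_left]
  refine ENNReal.tsum_le_tsum fun k => ?_
  rw [← mul_assoc]
  gcongr
  rw [polyWeight_inv (abs_nonneg _), ← ENNReal.ofReal_mul (by positivity)]
  refine ENNReal.ofReal_le_ofReal ?_
  have hk := znorm_nonneg k
  set s := |znorm k - r| with hs
  have hs0 : 0 ≤ s := abs_nonneg _
  have h1 : 1 + r ≤ (1 + znorm k) * (1 + s) := by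
    have : r - znorm k ≤ s := by rw [hs, abs_sub_comm]; exact le_abs_self _
    nlinarith [mul_nonneg hk hs0]
  have h2 : (1 + s) ^ 2 ≤ (1 + s) ^ q := by
    rw [← Real.rpow_natCast]
    exact Real.rpow_le_rpow_of_exponent_le (by linarith) (by exact_mod_cast hq)
  calc ((1 + s) ^ q)⁻¹ ≤ ((1 + s) ^ 2)⁻¹ := by gcongr
    _ ≤ ((1 + r) ^ 2)⁻¹ * (1 + znorm k) ^ 2 := by
      rw [inv_mul_eq_div, inv_eq_one_div, div_le_div_iff₀ (by positivity) (by positivity), one_mul,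
        ← mul_pow]
      gcongr

/-- A single realisation of the advection–diffusion system, with velocity bounded by `D` in the
weighted norm of order `q`. -/
structure AdvectionPath {d : ℕ} (ν q D : ℝ) (v : ℝ → (Fin d → ℤ) → Fin d → ℂ)
    (a : ℝ → (Fin d → ℤ) → ℂ) : Prop where
  divFree : ∀ t, 0 ≤ t → DivFree (v t)
  real : ∀ t, 0 ≤ t → RealCoeff (v t)
  velocity : ∀ t, 0 ≤ t →
    ∑' k, ENNReal.ofReal ((1 + znorm k) ^ q * cnorm (v t k)) ≤ ENNReal.ofReal D
  deriv : ∀ (k : Fin d → ℤ), ∀ t ∈ Set.Ici (0 : ℝ),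
    HasDerivWithinAt (fun s => a s k) (fourierRHS ν (v t) (a t) k) (Set.Ici 0) t
  moment : ∀ N : ℕ, ∀ T > (0 : ℝ), ∃ M : ℝ, ∀ t ∈ Set.Icc (0 : ℝ) T,
    ∑' k : Fin d → ℤ, ENNReal.ofReal ((1 + znorm k) ^ N) * (‖a t k‖₊ : ℝ≥0∞) ^ 2
      ≤ ENNReal.ofReal M
  initial : ∑' k, (‖a 0 k‖₊ : ℝ≥0∞) ^ 2 = 1

namespace AdvectionPath

variable {d : ℕ} {ν q D : ℝ} {v : ℝ → (Fin d → ℤ) → Fin d → ℂ} {a : ℝ → (Fin d → ℤ) → ℂ}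

lemma mass_ne_top (h : AdvectionPath ν q D v a) {t : ℝ} (ht : 0 ≤ t) :
    ∑' k, (‖a t k‖₊ : ℝ≥0∞) ^ 2 ≠ ⊤ := by
  obtain ⟨M, hM⟩ := h.moment 0 (t + 1) (by linarith)
  refine ne_top_of_le_ne_top ENNReal.ofReal_ne_top (le_trans (le_of_eq ?_)
    (hM t ⟨ht, by linarith⟩))
  simp

lemma hasDerivWithinAt_energy (h : AdvectionPath ν q D v a) (r : ℝ) {t : ℝ} (ht : 0 ≤ t) :
    HasDerivWithinAt (fun s => ∑ k ∈ latticeBall d r, ‖a s k‖ ^ 2)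
      (∑ k ∈ latticeBall d r, 2 * inner ℝ (a t k) (fourierRHS ν (v t) (a t) k)) (Set.Ici 0) t :=
  HasDerivWithinAt.fun_sum fun k _ => (h.deriv k t ht).norm_sq

lemma continuousOn_energy (h : AdvectionPath ν q D v a) (r T : ℝ) :
    ContinuousOn (fun s => ∑ k ∈ latticeBall d r, ‖a s k‖ ^ 2) (Icc 0 T) := fun _ ht =>
  ((h.hasDerivWithinAt_energy r ht.1).continuousWithinAt).mono Icc_subset_Ici_self

lemma mass_le_one (h : AdvectionPath ν q D v a) (hν : 0 ≤ ν) (hq : 2 ≤ q) (hD : 0 ≤ D)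
    {T : ℝ} (hT : 0 ≤ T) : ∑' k, (‖a T k‖₊ : ℝ≥0∞) ^ 2 ≤ 1 := by
  obtain ⟨M, hM⟩ := h.moment 2 (T + 1) (by linarith)
  have hM' : ∀ t ∈ Icc 0 T, ∑' k : Fin d → ℤ,
      ENNReal.ofReal ((1 + znorm k) ^ 2) * (‖a t k‖₊ : ℝ≥0∞) ^ 2 ≤ ENNReal.ofReal |M| :=
    fun t ht => (hM t ⟨ht.1, by linarith [ht.2]⟩).trans
      (ENNReal.ofReal_le_ofReal (le_abs_self M))
  have hinit : ∀ S : Finset (Fin d → ℤ), ∑ k ∈ S, ‖a 0 k‖ ^ 2 ≤ 1 := by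
    intro S
    have h1 := (ENNReal.sum_le_tsum (f := fun k => (‖a 0 k‖₊ : ℝ≥0∞) ^ 2) S).trans h.initial.le
    have h2 := ENNReal.toReal_mono ENNReal.one_ne_top h1
    rw [ENNReal.toReal_sum (fun k _ => by finiteness)] at h2
    simpa using h2
  have hgrow : ∀ r, 0 ≤ r → ∑ k ∈ latticeBall d r, ‖a T k‖ ^ 2
      ≤ 1 + 8 * π * D * |M| * T * (1 + r)⁻¹ := by
    intro r hr
    have key := intervalIntegral.sub_le_integral_of_hasDeriv_right_of_le
      (φ := fun _ => 8 * π * D * |M| * (1 + r)⁻¹) hT (h.continuousOn_energy r T)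
      (fun x hx => (h.hasDerivWithinAt_energy r hx.1.le).mono
        (Ioi_subset_Ici_self.trans (Ici_subset_Ici.mpr hx.1.le)))
      (integrableOn_const (by simp)) (by
        intro x hx
        have hx0 : (0 : ℝ) ≤ x := hx.1.le
        have h1 := (abs_le.mp (abs_energy_rate_le (ν := ν) (r := r) (by linarith : 0 ≤ q) hD hr
          (v x) (a x) (h.divFree x hx0) (h.real x hx0) (h.velocity x hx0)
          (h.mass_ne_top hx0))).2
        have h2 := ENNReal.toReal_mono (by finiteness) (convMass_polyWeight_le_of_moment hq hr
          (a x) (hM' x ⟨hx0, hx.2.le⟩))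
        rw [ENNReal.toReal_mul, ENNReal.toReal_ofReal (by positivity),
          ENNReal.toReal_ofReal (abs_nonneg M)] at h2
        have h3 : 0 ≤ 8 * π ^ 2 * ν * ∑ k ∈ latticeBall d r, znorm k ^ 2 * ‖a x k‖ ^ 2 := by
          positivity
        have h4 : r * ((1 + r) ^ 2)⁻¹ ≤ (1 + r)⁻¹ := by
          rw [← div_eq_mul_inv, inv_eq_one_div, div_le_div_iff₀ (by positivity) (by positivity)]
          nlinarith
        calc _ ≤ 8 * π * r * D * (convMass (polyWeight q) (a x) r).toReal := by linarith
          _ ≤ 8 * π * r * D * (((1 + r) ^ 2)⁻¹ * |M|) := by gcongr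
          _ = 8 * π * D * |M| * (r * ((1 + r) ^ 2)⁻¹) := by ring
          _ ≤ _ := by gcongr)
    simp only [intervalIntegral.integral_const, smul_eq_mul, sub_zero] at key
    linarith [hinit (latticeBall d r)]
  rw [ENNReal.tsum_eq_iSup_sum]
  refine iSup_le fun S => ?_
  have hreal : ∑ k ∈ S, ‖a T k‖ ^ 2 ≤ 1 := by
    have hlim : Filter.Tendsto (fun r : ℝ => 1 + 8 * π * D * |M| * T * (1 + r)⁻¹) Filter.atTop
        (nhds (1 + 8 * π * D * |M| * T * 0)) :=
      ((tendsto_inv_atTop_zero.comp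
        (Filter.tendsto_atTop_add_const_left _ 1 Filter.tendsto_id)).const_mul _).const_add 1
    rw [mul_zero, add_zero] at hlim
    refine ge_of_tendsto hlim ?_
    filter_upwards [Filter.eventually_ge_atTop (0 : ℝ),
      Filter.eventually_gt_atTop (∑ k ∈ S, znorm k)] with r hr hrS
    refine le_trans (Finset.sum_le_sum_of_subset_of_nonneg ?_ fun _ _ _ => sq_nonneg _)
      (hgrow r hr)
    intro k hk
    rw [mem_latticeBall]
    exact (Finset.single_le_sum (fun k _ => znorm_nonneg k) hk).trans_lt hrS
  have := ENNReal.ofReal_le_ofReal hreal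
  rw [ENNReal.ofReal_sum_of_nonneg (fun _ _ => sq_nonneg _), ENNReal.ofReal_one] at this
  refine le_trans (le_of_eq (Finset.sum_congr rfl fun k _ => ?_)) this
  rw [ENNReal.ofReal_pow (norm_nonneg _), ofReal_norm, enorm_eq_nnnorm]

/-- Integrated energy balance in the ball of radius `r`. -/
lemma energy_initial_le (h : AdvectionPath ν q D v a) (hν : 0 ≤ ν) (hq : 2 ≤ q) (hD : 0 ≤ D)
    (hmeas : ∀ k, Measurable fun t => a t k) {r T : ℝ} (hr : 0 ≤ r) (hT : 0 ≤ T) :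
    ∑ k ∈ latticeBall d r, (‖a 0 k‖₊ : ℝ≥0∞) ^ 2
      ≤ ∑ k ∈ latticeBall d r, (‖a T k‖₊ : ℝ≥0∞) ^ 2 + ENNReal.ofReal (8 * π ^ 2 * ν * r ^ 2 * T)
        + ENNReal.ofReal (8 * π * r * D) *
          ∫⁻ t in Icc 0 T, convMass (polyWeight q) (a t) r := by
  set F : ℝ → ℝ≥0∞ := fun t => convMass (polyWeight q) (a t) r with hF
  have hFm : Measurable F := Measurable.tsum fun k => by
    have := hmeas k
    fun_prop
  have hF1 : ∀ t, 0 ≤ t → F t ≤ 1 := fun t ht =>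
    (convMass_polyWeight_le (by linarith) (a t) r).trans (h.mass_le_one hν hq hD ht)
  have hFint : ∫⁻ t in Icc 0 T, F t ≠ ⊤ := by
    refine ne_top_of_le_ne_top (b := ∫⁻ _ in Icc 0 T, 1) (by simp) ?_
    exact setLIntegral_mono measurable_const fun t ht => hF1 t ht.1
  have hFi : IntegrableOn (fun t => (F t).toReal) (Icc 0 T) :=
    integrable_toReal_of_lintegral_ne_top hFm.aemeasurable hFint
  have key := intervalIntegral.sub_le_integral_of_hasDeriv_right_of_le
    (φ := fun t => 8 * π ^ 2 * ν * r ^ 2 + 8 * π * r * D * (F t).toReal) hT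
    (h.continuousOn_energy r T).fun_neg
    (fun x hx => ((h.hasDerivWithinAt_energy r hx.1.le).mono
      (Ioi_subset_Ici_self.trans (Ici_subset_Ici.mpr hx.1.le))).fun_neg)
    (((integrableOn_const (by simp))).add (hFi.const_mul _)) (by
      intro x hx
      have hx0 : (0 : ℝ) ≤ x := hx.1.le
      have h1 := (abs_le.mp (abs_energy_rate_le (ν := ν) (r := r) (by linarith : 0 ≤ q) hD hr
        (v x) (a x) (h.divFree x hx0) (h.real x hx0) (h.velocity x hx0)
        (h.mass_ne_top hx0))).1
      have h2 : ∑ k ∈ latticeBall d r, ‖a x k‖ ^ 2 ≤ 1 := by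
        have h3 := ENNReal.toReal_mono ENNReal.one_ne_top
          ((ENNReal.sum_le_tsum (f := fun k => (‖a x k‖₊ : ℝ≥0∞) ^ 2) (latticeBall d r)).trans
            (h.mass_le_one hν hq hD hx0))
        rw [ENNReal.toReal_sum (fun k _ => by finiteness)] at h3
        simpa using h3
      have h4 : ∑ k ∈ latticeBall d r, znorm k ^ 2 * ‖a x k‖ ^ 2 ≤ r ^ 2 * 1 := by
        refine le_trans ?_ (mul_le_mul_of_nonneg_left h2 (sq_nonneg r))
        rw [Finset.mul_sum]
        refine Finset.sum_le_sum fun k hk => ?_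
        have := (mem_latticeBall.mp hk).le
        have := znorm_nonneg k
        gcongr
      have h5 : 8 * π ^ 2 * ν * ∑ k ∈ latticeBall d r, znorm k ^ 2 * ‖a x k‖ ^ 2
          ≤ 8 * π ^ 2 * ν * (r ^ 2 * 1) := by gcongr
      linarith)
  have hint : ∫ t in (0 : ℝ)..T, (8 * π ^ 2 * ν * r ^ 2 + 8 * π * r * D * (F t).toReal)
      = 8 * π ^ 2 * ν * r ^ 2 * T + 8 * π * r * D * (∫⁻ t in Icc 0 T, F t).toReal := by
    rw [intervalIntegral.integral_of_le hT, ← integral_Icc_eq_integral_Ioc,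
      integral_add (integrable_const _) (hFi.const_mul _),
      integral_const_mul (8 * π * r * D) fun t => (F t).toReal,
      integral_toReal hFm.aemeasurable
        ((ae_restrict_iff' measurableSet_Icc).mpr (Filter.Eventually.of_forall fun _ ht =>
          (hF1 _ ht.1).trans_lt ENNReal.one_lt_top))]
    simp [hT]
    ring
  rw [hint] at key
  have hconv : ∀ t, ∑ k ∈ latticeBall d r, (‖a t k‖₊ : ℝ≥0∞) ^ 2
      = ENNReal.ofReal (∑ k ∈ latticeBall d r, ‖a t k‖ ^ 2) := by
    intro t
    rw [ENNReal.ofReal_sum_of_nonneg (fun _ _ => sq_nonneg _)]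
    refine Finset.sum_congr rfl fun k _ => ?_
    rw [ENNReal.ofReal_pow (norm_nonneg _), ofReal_norm, enorm_eq_nnnorm]
  rw [hconv, hconv]
  conv_rhs => rw [← ENNReal.ofReal_toReal hFint]
  rw [← ENNReal.ofReal_mul (by positivity), ← ENNReal.ofReal_add (by positivity) (by positivity),
    ← ENNReal.ofReal_add (by positivity) (by positivity)]
  refine ENNReal.ofReal_le_ofReal ?_
  linarith

/-- The mean is conserved, hence zero if it is zero initially. -/
lemma apply_zero (h : AdvectionPath ν q D v a) (h0 : a 0 0 = 0) {t : ℝ} (ht : 0 ≤ t) :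
    a t 0 = 0 := by
  have hz : ∀ s, fourierRHS ν (v s) (a s) 0 = 0 := by
    intro s
    simp [fourierRHS, znorm_zero, zdot]
  have := constant_of_has_deriv_right_zero (f := fun s => a s 0) (a := 0) (b := t)
    (fun s hs => ((h.deriv 0 s hs.1).continuousWithinAt).mono Icc_subset_Ici_self)
    (fun s hs => by
      have h1 := h.deriv 0 s hs.1
      rw [hz] at h1
      exact h1.mono (Ici_subset_Ici.mpr hs.1)) t ⟨ht, le_rfl⟩
  rw [this, h0]

end AdvectionPath

/-! ### Expected time-integrated mass of the Fourier modes -/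

/-- The expected time-integrated mass of the mode `k`. -/
def modeMass {d : ℕ} {Ω : Type*} [MeasurableSpace Ω] (ℙ : Measure Ω)
    (a : Ω → ℝ → (Fin d → ℤ) → ℂ) (k : Fin d → ℤ) : ℝ≥0∞ :=
  ∫⁻ ω, (∫⁻ t in Set.Ici (0 : ℝ), (‖a ω t k‖₊ : ℝ≥0∞) ^ 2) ∂ℙ

section Expectation

variable {d : ℕ} {Ω : Type*} [MeasurableSpace Ω] {ℙ : Measure Ω}
  {a : Ω → ℝ → (Fin d → ℤ) → ℂ}

lemma measurable_weighted_mass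
    (hmeas : ∀ k : Fin d → ℤ, Measurable fun p : Ω × ℝ => a p.1 p.2 k)
    (w : (Fin d → ℤ) → ℝ≥0∞) :
    Measurable fun p : Ω × ℝ => ∑' k, w k * (‖a p.1 p.2 k‖₊ : ℝ≥0∞) ^ 2 :=
  Measurable.tsum fun k => by
    have := hmeas k
    fun_prop

lemma lintegral_weighted_mass
    (hmeas : ∀ k : Fin d → ℤ, Measurable fun p : Ω × ℝ => a p.1 p.2 k)
    (w : (Fin d → ℤ) → ℝ≥0∞) :
    ∫⁻ ω, (∫⁻ t in Set.Ici (0 : ℝ), ∑' k, w k * (‖a ω t k‖₊ : ℝ≥0∞) ^ 2) ∂ℙ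
      = ∑' k, w k * modeMass ℙ a k := by
  have hsec : ∀ k ω, Measurable fun t => (‖a ω t k‖₊ : ℝ≥0∞) ^ 2 := fun k ω => by
    have : Measurable fun t => a ω t k := (hmeas k).comp measurable_prodMk_left
    fun_prop
  have hpair : ∀ k, Measurable fun p : Ω × ℝ => (‖a p.1 p.2 k‖₊ : ℝ≥0∞) ^ 2 := fun k => by
    have := hmeas k
    fun_prop
  simp_rw [lintegral_tsum fun k => ((hsec k _).const_mul (w k)).aemeasurable,
    lintegral_const_mul _ (hsec _ _)]
  rw [lintegral_tsum fun k => (((hpair k).lintegral_prod_right').const_mul (w k)).aemeasurable]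
  refine tsum_congr fun k => ?_
  rw [lintegral_const_mul _ (hpair k).lintegral_prod_right']
  rfl

lemma asymMass_eq_tsum
    (hmeas : ∀ k : Fin d → ℤ, Measurable fun p : Ω × ℝ => a p.1 p.2 k) (E : Set ℝ) :
    asymMass ℙ a E = ∑' k, if znorm k ∈ E then modeMass ℙ a k else 0 := by
  have h := lintegral_weighted_mass (ℙ := ℙ) hmeas fun k => if znorm k ∈ E then 1 else 0
  simpa [asymMass, massOn] using h

variable {ν K γ q D : ℝ} {v : Ω → ℝ → (Fin d → ℤ) → Fin d → ℂ}
  {g : (Fin d → ℤ) → ℂ}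

lemma AdvectionSetup.ae_path (hs : AdvectionSetup ℙ ν K γ v a g)
    (hv : ∀ᵐ ω ∂ℙ, ∀ t : ℝ, 0 ≤ t →
        (∑' k : Fin d → ℤ, ENNReal.ofReal ((1 + znorm k) ^ q * cnorm (v ω t k)))
          ≤ ENNReal.ofReal D) :
    ∀ᵐ ω ∂ℙ, a ω 0 = g ∧ AdvectionPath ν q D (v ω) (a ω) := by
  obtain ⟨-, -, -, hg1, hae, -⟩ := hs
  filter_upwards [hae, hv] with ω h hvω
  exact ⟨h.2.1, fun t ht => (h.1 t ht).1, fun t ht => (h.1 t ht).2, hvω, h.2.2.1, h.2.2.2,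
    by rw [h.2.1]; exact hg1⟩

variable [IsProbabilityMeasure ℙ]

/-- Every sphere outside the initial support and below the dissipation scale is crossed by a
definite amount of mass, hence carries mass nearby. -/
lemma AdvectionSetup.flux_lower_bound (hs : AdvectionSetup ℙ ν K γ v a g)
    (hv : ∀ᵐ ω ∂ℙ, ∀ t : ℝ, 0 ≤ t →
        (∑' k : Fin d → ℤ, ENNReal.ofReal ((1 + znorm k) ^ q * cnorm (v ω t k)))
          ≤ ENNReal.ofReal D) (hν : 0 ≤ ν) (hq : 2 ≤ q) (hD : 0 ≤ D)
    {r T : ℝ} (hr : 0 ≤ r) (hT : 0 ≤ T)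
    (hg : massOn g (Set.Ici r) ≤ ENNReal.ofReal (1 / 4))
    (hmix : (2 * π * r) ^ 2 * (K * Real.exp (-γ * T)) ≤ 1 / 4)
    (hdiss : 8 * π ^ 2 * ν * r ^ 2 * T ≤ 1 / 4) :
    ENNReal.ofReal (1 / 4) ≤ ENNReal.ofReal (8 * π * r * D) *
      ∑' k, (polyWeight q |znorm k - r|)⁻¹ * modeMass ℙ a k := by
  have hpath := hs.ae_path hv
  obtain ⟨hmeas, -, hg0, hg1, -, hmixing⟩ := hs
  have hinit : 1 ≤ ∑ k ∈ latticeBall d r, (‖g k‖₊ : ℝ≥0∞) ^ 2 + ENNReal.ofReal (1 / 4) := by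
    rw [← hg1]
    refine le_trans (le_of_eq ?_) (add_le_add_right hg _)
    have : ∑ k ∈ latticeBall d r, (‖g k‖₊ : ℝ≥0∞) ^ 2
        = ∑' k, if k ∈ latticeBall d r then (‖g k‖₊ : ℝ≥0∞) ^ 2 else 0 := by
      rw [tsum_eq_sum (s := latticeBall d r) (fun k hk => if_neg hk)]
      exact Finset.sum_congr rfl fun k hk => (if_pos hk).symm
    rw [this, massOn, ← ENNReal.tsum_add]
    refine tsum_congr fun k => ?_
    by_cases hk : znorm k < r
    · simp [mem_latticeBall, hk, not_le.mpr hk]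
    · simp [mem_latticeBall, hk, not_lt.mp hk]
  have hsec : ∀ ω k, Measurable fun t => a ω t k := fun ω k =>
    (hmeas k).comp measurable_prodMk_left
  set c := ENNReal.ofReal (8 * π * r * D)
  have hbal : ∀ᵐ ω ∂ℙ, 1 ≤ ∑ k ∈ latticeBall d r, (‖a ω T k‖₊ : ℝ≥0∞) ^ 2
      + (ENNReal.ofReal (1 / 4) + ENNReal.ofReal (1 / 4)
        + c * ∫⁻ t in Ici 0, convMass (polyWeight q) (a ω t) r) := by
    filter_upwards [hpath] with ω hω
    have h1 := hω.2.energy_initial_le hν hq hD (hsec ω) hr hT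
    rw [hω.1] at h1
    refine hinit.trans ((add_le_add_left h1 _).trans ?_)
    have h2 : ENNReal.ofReal (8 * π ^ 2 * ν * r ^ 2 * T) ≤ ENNReal.ofReal (1 / 4) :=
      ENNReal.ofReal_le_ofReal hdiss
    have h3 : ∫⁻ t in Icc 0 T, convMass (polyWeight q) (a ω t) r
        ≤ ∫⁻ t in Ici 0, convMass (polyWeight q) (a ω t) r :=
      lintegral_mono_set Icc_subset_Ici_self
    calc _ ≤ ∑ k ∈ latticeBall d r, (‖a ω T k‖₊ : ℝ≥0∞) ^ 2 + ENNReal.ofReal (1 / 4)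
          + c * (∫⁻ t in Ici 0, convMass (polyWeight q) (a ω t) r) + ENNReal.ofReal (1 / 4) := by
          gcongr
      _ = _ := by ring
  have hlow : ∫⁻ ω, ∑ k ∈ latticeBall d r, (‖a ω T k‖₊ : ℝ≥0∞) ^ 2 ∂ℙ
      ≤ ENNReal.ofReal (1 / 4) := by
    calc _ ≤ ∫⁻ ω, ENNReal.ofReal ((2 * π * r) ^ 2) * ∑' k : Fin d → ℤ, (if k = 0 then 0 else
        (ENNReal.ofReal ((2 * π * znorm k) ^ 2))⁻¹ * (‖a ω T k‖₊ : ℝ≥0∞) ^ 2) ∂ℙ := by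
          refine lintegral_mono_ae ?_
          filter_upwards [hpath] with ω hω
          have h0 : a ω T 0 = 0 := hω.2.apply_zero (by rw [hω.1, hg0]) hT
          rw [← ENNReal.tsum_mul_left]
          refine le_trans (Finset.sum_le_sum fun k hk => ?_) (ENNReal.sum_le_tsum _)
          by_cases hk0 : k = 0
          · simp [hk0, h0]
          · rw [if_neg hk0, ← mul_assoc]
            refine le_mul_of_one_le_left' ?_
            have hz : 0 < znorm k := lt_of_lt_of_le one_pos (one_le_znorm hk0)
            have hkr := (mem_latticeBall.mp hk).le
            rw [← div_eq_mul_inv, ENNReal.le_div_iff_mul_le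
              (Or.inl (ENNReal.ofReal_pos.mpr (by positivity)).ne')
              (Or.inl ENNReal.ofReal_ne_top), one_mul]
            exact ENNReal.ofReal_le_ofReal (by gcongr)
      _ = ENNReal.ofReal ((2 * π * r) ^ 2) * ∫⁻ ω, ∑' k : Fin d → ℤ, (if k = 0 then 0 else
        (ENNReal.ofReal ((2 * π * znorm k) ^ 2))⁻¹ * (‖a ω T k‖₊ : ℝ≥0∞) ^ 2) ∂ℙ :=
          lintegral_const_mul' _ _ ENNReal.ofReal_ne_top
      _ ≤ ENNReal.ofReal ((2 * π * r) ^ 2) * ENNReal.ofReal (K * Real.exp (-γ * T)) := by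
          gcongr
          exact hmixing T hT
      _ ≤ _ := by
          rw [← ENNReal.ofReal_mul (by positivity)]
          exact ENNReal.ofReal_le_ofReal hmix
  have hFm : Measurable fun ω => ∫⁻ t in Ici 0, convMass (polyWeight q) (a ω t) r :=
    (measurable_weighted_mass hmeas fun k => (polyWeight q |znorm k - r|)⁻¹).lintegral_prod_right'
  have hint := lintegral_mono_ae hbal
  have hsum : Measurable fun ω => ENNReal.ofReal (1 / 4) + ENNReal.ofReal (1 / 4)
      + c * ∫⁻ t in Ici 0, convMass (polyWeight q) (a ω t) r :=
    measurable_const.add (hFm.const_mul c)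
  rw [lintegral_const, measure_univ, mul_one, lintegral_add_right _ hsum, lintegral_add_left measurable_const,
    lintegral_const, measure_univ, mul_one, lintegral_const_mul _ hFm] at hint
  have hF := lintegral_weighted_mass (ℙ := ℙ) hmeas fun k => (polyWeight q |znorm k - r|)⁻¹
  rw [← hF]
  have hint' : (1 : ℝ≥0∞) ≤ ENNReal.ofReal (3 / 4) + c * ∫⁻ ω, (∫⁻ t in Ici 0,
      convMass (polyWeight q) (a ω t) r) ∂ℙ := by
    refine hint.trans ((add_le_add_left hlow _).trans (le_of_eq ?_))
    rw [← add_assoc, ← ENNReal.ofReal_add (by norm_num) (by norm_num),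
      ← ENNReal.ofReal_add (by norm_num) (by norm_num)]
    norm_num
  have h34 : (1 : ℝ≥0∞) = ENNReal.ofReal (3 / 4) + ENNReal.ofReal (1 / 4) := by
    rw [← ENNReal.ofReal_add (by norm_num) (by norm_num)]
    norm_num
  rw [h34] at hint'
  exact (ENNReal.add_le_add_iff_left ENNReal.ofReal_ne_top).mp hint'

/-- Mixing together with energy decay bounds the total mass below the scale `ρ`. -/
lemma AdvectionSetup.low_mass_le (hs : AdvectionSetup ℙ ν K γ v a g)
    (hv : ∀ᵐ ω ∂ℙ, ∀ t : ℝ, 0 ≤ t →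
        (∑' k : Fin d → ℤ, ENNReal.ofReal ((1 + znorm k) ^ q * cnorm (v ω t k)))
          ≤ ENNReal.ofReal D) (hν : 0 ≤ ν) (hq : 2 ≤ q) (hD : 0 ≤ D) (hγ : 0 < γ) (hK : 1 ≤ K)
    {ρ : ℝ} (hρ : 1 ≤ ρ) {β : (Fin d → ℤ) → ℝ≥0∞} (hβ1 : ∀ k, β k ≤ 1)
    (hβ : ∀ k, k ≠ 0 → β k ≤ ENNReal.ofReal (ρ ^ 2 * (znorm k ^ 2)⁻¹)) :
    ∑' k, β k * modeMass ℙ a k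
      ≤ ENNReal.ofReal ((Real.log (4 * π ^ 2 * K * ρ ^ 2) + 1) / γ) := by
  have hpath := hs.ae_path hv
  obtain ⟨hmeas, -, hg0, hg1, -, hmixing⟩ := hs
  set B := 4 * π ^ 2 * K * ρ ^ 2 with hB
  have hB1 : 1 ≤ B := by
    have hpi : 1 ≤ π ^ 2 := by nlinarith [Real.pi_gt_three]
    have h1 : 1 ≤ π ^ 2 * K := one_le_mul_of_one_le_of_one_le hpi hK
    have h2 : 1 ≤ ρ ^ 2 := one_le_pow₀ hρ
    have h3 : 1 ≤ (π ^ 2 * K) * ρ ^ 2 := one_le_mul_of_one_le_of_one_le h1 h2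
    rw [hB]; nlinarith
  set T := Real.log B / γ with hT
  have hT0 : 0 ≤ T := div_nonneg (Real.log_nonneg hB1) hγ.le
  rw [← lintegral_weighted_mass hmeas β, lintegral_lintegral_swap
    (measurable_weighted_mass hmeas β).aemeasurable]
  have hone : ∀ t, 0 ≤ t →
      ∫⁻ ω, ∑' k, β k * (‖a ω t k‖₊ : ℝ≥0∞) ^ 2 ∂ℙ ≤ 1 := by
    intro t ht
    calc _ ≤ ∫⁻ _, 1 ∂ℙ := by
          refine lintegral_mono_ae ?_
          filter_upwards [hpath] with ω hω
          refine le_trans (ENNReal.tsum_le_tsum fun k => ?_) (hω.2.mass_le_one hν hq hD ht)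
          exact mul_le_of_le_one_left' (hβ1 k)
      _ = 1 := by simp
  have hexp : ∀ t, 0 ≤ t →
      ∫⁻ ω, ∑' k, β k * (‖a ω t k‖₊ : ℝ≥0∞) ^ 2 ∂ℙ ≤ ENNReal.ofReal (B * Real.exp (-γ * t)) := by
    intro t ht
    calc _ ≤ ∫⁻ ω, ENNReal.ofReal (4 * π ^ 2 * ρ ^ 2) * ∑' k : Fin d → ℤ,
          (if k = 0 then 0 else
          (ENNReal.ofReal ((2 * π * znorm k) ^ 2))⁻¹ * (‖a ω t k‖₊ : ℝ≥0∞) ^ 2) ∂ℙ := by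
          refine lintegral_mono_ae ?_
          filter_upwards [hpath] with ω hω
          have h0 : a ω t 0 = 0 := hω.2.apply_zero (by rw [hω.1, hg0]) ht
          rw [← ENNReal.tsum_mul_left]
          refine ENNReal.tsum_le_tsum fun k => ?_
          by_cases hk0 : k = 0
          · simp [hk0, h0]
          · rw [if_neg hk0, ← mul_assoc]
            gcongr
            refine (hβ k hk0).trans ?_
            have hz : 0 < znorm k := lt_of_lt_of_le one_pos (one_le_znorm hk0)
            rw [← ENNReal.ofReal_inv_of_pos (by positivity), ← ENNReal.ofReal_mul (by positivity)]
            refine ENNReal.ofReal_le_ofReal (le_of_eq ?_)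
            field_simp
            ring
      _ = ENNReal.ofReal (4 * π ^ 2 * ρ ^ 2) * ∫⁻ ω, ∑' k : Fin d → ℤ, (if k = 0 then 0 else
          (ENNReal.ofReal ((2 * π * znorm k) ^ 2))⁻¹ * (‖a ω t k‖₊ : ℝ≥0∞) ^ 2) ∂ℙ :=
          lintegral_const_mul' _ _ ENNReal.ofReal_ne_top
      _ ≤ ENNReal.ofReal (4 * π ^ 2 * ρ ^ 2) * ENNReal.ofReal (K * Real.exp (-γ * t)) := by
          gcongr
          exact hmixing t ht
      _ = _ := by
          rw [← ENNReal.ofReal_mul (by positivity)]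
          congr 1
          rw [hB]
          ring
  have htail : ∫⁻ t in Ioi T, ENNReal.ofReal (B * Real.exp (-γ * t)) = ENNReal.ofReal (1 / γ) := by
    have hi : IntegrableOn (fun t => B * Real.exp (-γ * t)) (Ioi T) :=
      (integrableOn_exp_mul_Ioi (by linarith) T).const_mul B
    rw [← ofReal_integral_eq_lintegral_ofReal hi (Filter.Eventually.of_forall fun t => by
      simp only [Pi.zero_apply]; positivity), integral_const_mul,
      integral_exp_mul_Ioi (by linarith)]
    congr 1
    have : -γ * T = -Real.log B := by rw [hT]; field_simp
    rw [this, Real.exp_neg, Real.exp_log (by linarith)]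
    field_simp
  calc _ ≤ ∫⁻ t in Icc 0 T ∪ Ioi T, ∫⁻ ω, ∑' k, β k * (‖a ω t k‖₊ : ℝ≥0∞) ^ 2 ∂ℙ := by
        refine lintegral_mono_set ?_
        rw [Icc_union_Ioi_eq_Ici hT0]
    _ ≤ _ := lintegral_union_le _ _ _
    _ ≤ (∫⁻ t in Icc 0 T, 1) + ∫⁻ t in Ioi T, ENNReal.ofReal (B * Real.exp (-γ * t)) :=
        add_le_add (setLIntegral_mono measurable_const fun t ht => hone t ht.1)
          (setLIntegral_mono (by fun_prop) fun t ht => hexp t (hT0.trans (le_of_lt ht)))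
    _ = _ := by
        rw [htail, setLIntegral_const, one_mul, Real.volume_Icc, sub_zero,
          ← ENNReal.ofReal_add hT0 (by positivity), hT, add_div]

end Expectation

/-! ### From flux to density -/

/-- The kernel `x ↦ 1 / (1 + x ^ 2)`. -/
def cauchyKernel (x : ℝ) : ℝ≥0∞ := ENNReal.ofReal ((1 + x ^ 2)⁻¹)

lemma measurable_cauchyKernel : Measurable cauchyKernel := by
  unfold cauchyKernel
  fun_prop

lemma lintegral_cauchyKernel_sub (x : ℝ) : ∫⁻ s, cauchyKernel (x - s) = ENNReal.ofReal π := by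
  rw [lintegral_sub_left_eq_self cauchyKernel x]
  unfold cauchyKernel
  rw [← ofReal_integral_eq_lintegral_ofReal integrable_inv_one_add_sq
    (Filter.Eventually.of_forall fun x => by simp only [Pi.zero_apply]; positivity),
    integral_univ_inv_one_add_sq]

lemma setLIntegral_cauchyKernel_le {R x : ℝ} (hR : 1 ≤ R) (hx : 1 ≤ x) :
    ∫⁻ s in Icc 0 (2 * R), cauchyKernel (x - s)
      ≤ ENNReal.ofReal π * ENNReal.ofReal ((4 * R) ^ 2 * (x ^ 2)⁻¹) := by
  have hpi := Real.pi_gt_three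
  rcases le_total x (4 * R) with h | h
  · refine (setLIntegral_le_lintegral _ _).trans ?_
    rw [lintegral_cauchyKernel_sub]
    refine le_mul_of_one_le_right' ?_
    rw [ENNReal.one_le_ofReal, ← div_eq_mul_inv, one_le_div (by positivity)]
    gcongr
  · calc _ ≤ ∫⁻ _ in Icc 0 (2 * R), ENNReal.ofReal (4 * (x ^ 2)⁻¹) := by
          refine setLIntegral_mono measurable_const fun s hs => ENNReal.ofReal_le_ofReal ?_
          rw [← div_eq_mul_inv, inv_eq_one_div, div_le_div_iff₀ (by positivity) (by positivity)]
          have : x / 2 ≤ x - s := by linarith [hs.2]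
          nlinarith
      _ = ENNReal.ofReal (4 * (x ^ 2)⁻¹ * (2 * R)) := by
          rw [setLIntegral_const, Real.volume_Icc, sub_zero, ← ENNReal.ofReal_mul (by positivity)]
      _ ≤ _ := by
          rw [← ENNReal.ofReal_mul (by positivity)]
          refine ENNReal.ofReal_le_ofReal ?_
          have h1 : 4 * (2 * R) ≤ π * (4 * R) ^ 2 := by nlinarith
          calc 4 * (x ^ 2)⁻¹ * (2 * R) = 4 * (2 * R) * (x ^ 2)⁻¹ := by ring
            _ ≤ π * (4 * R) ^ 2 * (x ^ 2)⁻¹ := by gcongr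
            _ = _ := by ring

lemma inv_polyWeight_le {q h r s x : ℝ} (hq : 2 ≤ q) (hh : 0 < h)
    (hs : s ∈ Icc (r + h / 4) (r + 3 * h / 4)) :
    (polyWeight q |x - s|)⁻¹ ≤ (if x ∈ Icc r (r + h) then cauchyKernel (x - s) else 0)
      + ENNReal.ofReal ((h / 4) ^ (2 - q)) * cauchyKernel (x - s) := by
  rw [polyWeight_inv (abs_nonneg _)]
  have h0 : 0 ≤ |x - s| := abs_nonneg _
  have hsq : 1 + (x - s) ^ 2 ≤ (1 + |x - s|) ^ 2 := by nlinarith [sq_abs (x - s)]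
  have hsplit : ((1 + |x - s|) ^ q)⁻¹ = (1 + |x - s|) ^ (2 - q) * ((1 + |x - s|) ^ 2)⁻¹ := by
    rw [Real.rpow_sub (by positivity), Real.rpow_two]
    field_simp
  split_ifs with hx
  · refine le_add_of_le_of_nonneg (ENNReal.ofReal_le_ofReal ?_) zero_le
    rw [hsplit]
    calc _ ≤ 1 * ((1 + |x - s|) ^ 2)⁻¹ := by
          gcongr
          exact Real.rpow_le_one_of_one_le_of_nonpos (by linarith) (by linarith)
      _ ≤ _ := by rw [one_mul]; gcongr
  · rw [zero_add, cauchyKernel, ← ENNReal.ofReal_mul (by positivity), hsplit]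
    refine ENNReal.ofReal_le_ofReal ?_
    have hfar : h / 4 ≤ 1 + |x - s| := by
      by_contra! hlt
      have := abs_lt.mp (show |x - s| < h / 4 by linarith)
      exact hx ⟨by linarith [hs.1], by linarith [hs.2]⟩
    have h1 : (1 + |x - s|) ^ (2 - q) ≤ (h / 4) ^ (2 - q) :=
      Real.rpow_le_rpow_of_nonpos (by positivity) hfar (by linarith)
    gcongr

section Density

variable {ι : Type*} [Countable ι] (x : ι → ℝ) (M : ι → ℝ≥0∞)

lemma measurable_cauchy_average : Measurable fun s => ∑' k, cauchyKernel (x k - s) * M k :=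
  Measurable.tsum fun k => by
    have := measurable_cauchyKernel
    fun_prop

/-- If the flux bound holds around an undercharged annulus, the mass seen through the Cauchy kernel
must be large there. -/
lemma inv_radius_le_of_undercharged {q h r C D : ℝ} (hq : 2 ≤ q) (hh : 0 < h) (hr : h ≤ r)
    (hC : 256 * π ^ 2 ≤ C) (hD : 0 < D)
    (hmass : ∑' k, (if x k ∈ Icc r (r + h) then M k else 0) ≤ ENNReal.ofReal (h / (C * D * r)))
    (hflux : ∀ s ∈ Icc (r + h / 4) (r + 3 * h / 4), ENNReal.ofReal (1 / 4) ≤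
      ENNReal.ofReal (8 * π * s * D) * ∑' k, (polyWeight q |x k - s|)⁻¹ * M k) :
    ENNReal.ofReal r⁻¹ ≤ ENNReal.ofReal (256 * π * D * h⁻¹ * (h / 4) ^ (2 - q)) *
      ∫⁻ s in Icc r (r + h), ∑' k, cauchyKernel (x k - s) * M k := by
  have hr0 : 0 < r := hh.trans_le hr
  have hpi := Real.pi_pos
  have hC0 : 0 < C := lt_of_lt_of_le (by positivity) hC
  set A : ℝ → ℝ≥0∞ := fun s => ∑' k, cauchyKernel (x k - s) * M k
  have hAm : Measurable A := measurable_cauchy_average x M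
  set N : ℝ → ℝ≥0∞ := fun s =>
    ∑' k, cauchyKernel (x k - s) * (if x k ∈ Icc r (r + h) then M k else 0)
  have hNm : Measurable N := measurable_cauchy_average x _
  set L := ENNReal.ofReal ((h / 4) ^ (2 - q))
  have hpt : ∀ s ∈ Icc (r + h / 4) (r + 3 * h / 4),
      ENNReal.ofReal (1 / (64 * π * r * D)) ≤ N s + L * A s := by
    intro s hs
    have hle : ∑' k, (polyWeight q |x k - s|)⁻¹ * M k ≤ N s + L * A s := by
      rw [← ENNReal.tsum_mul_left, ← ENNReal.tsum_add]
      refine ENNReal.tsum_le_tsum fun k => ?_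
      refine (mul_le_mul_left (inv_polyWeight_le hq hh hs) _).trans (le_of_eq ?_)
      split_ifs <;> ring
    have h1 := (hflux s hs).trans (mul_le_mul' (ENNReal.ofReal_le_ofReal
      (show 8 * π * s * D ≤ 16 * π * r * D by
        have : s ≤ 2 * r := by linarith [hs.2]
        have : π * D * s ≤ π * D * (2 * r) := by gcongr
        linarith)) hle)
    have h2 := mul_le_mul_right h1 (ENNReal.ofReal (1 / (16 * π * r * D)))
    rw [← mul_assoc, ← ENNReal.ofReal_mul (by positivity), ← ENNReal.ofReal_mul (by positivity),
      one_div_mul_cancel (by positivity), ENNReal.ofReal_one, one_mul] at h2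
    refine le_trans (ENNReal.ofReal_le_ofReal (le_of_eq ?_)) h2
    field_simp
    norm_num
  have hNint : ∫⁻ s in Icc (r + h / 4) (r + 3 * h / 4), N s
      ≤ ENNReal.ofReal (h / (256 * π * r * D)) := by
    refine (setLIntegral_le_lintegral _ _).trans ?_
    have hm : ∀ k, Measurable fun s => cauchyKernel (x k - s) := fun k => by
      have := measurable_cauchyKernel
      fun_prop
    rw [lintegral_tsum fun k => ((hm k).mul_const _).aemeasurable]
    simp_rw [lintegral_mul_const _ (hm _), lintegral_cauchyKernel_sub, ENNReal.tsum_mul_left]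
    refine (mul_le_mul_right hmass _).trans ?_
    rw [← ENNReal.ofReal_mul hpi.le]
    refine ENNReal.ofReal_le_ofReal ?_
    rw [← mul_div_assoc, div_le_div_iff₀ (by positivity) (by positivity)]
    calc π * h * (256 * π * r * D) = h * r * D * (256 * π ^ 2) := by ring
      _ ≤ h * r * D * C := by gcongr
      _ = _ := by ring
  have hint : ENNReal.ofReal (h / (128 * π * r * D))
      ≤ ENNReal.ofReal (h / (256 * π * r * D)) + L * ∫⁻ s in Icc r (r + h), A s := by
    calc _ = ∫⁻ _ in Icc (r + h / 4) (r + 3 * h / 4), ENNReal.ofReal (1 / (64 * π * r * D)) := by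
          rw [setLIntegral_const, Real.volume_Icc, ← ENNReal.ofReal_mul (by positivity)]
          congr 1
          field_simp
          ring
      _ ≤ ∫⁻ s in Icc (r + h / 4) (r + 3 * h / 4), (N s + L * A s) :=
          setLIntegral_mono (hNm.add (hAm.const_mul L)) hpt
      _ = (∫⁻ s in Icc (r + h / 4) (r + 3 * h / 4), N s)
          + L * ∫⁻ s in Icc (r + h / 4) (r + 3 * h / 4), A s := by
          rw [lintegral_add_left hNm, lintegral_const_mul _ hAm]
      _ ≤ _ := by
          gcongr
          · linarith
          · linarith
  have hsplit : ENNReal.ofReal (h / (128 * π * r * D))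
      = ENNReal.ofReal (h / (256 * π * r * D)) + ENNReal.ofReal (h / (256 * π * r * D)) := by
    rw [← ENNReal.ofReal_add (by positivity) (by positivity)]
    congr 1
    field_simp
    norm_num
  rw [hsplit] at hint
  have hfin := (ENNReal.add_le_add_iff_left ENNReal.ofReal_ne_top).mp hint
  have h3 := mul_le_mul_right hfin (ENNReal.ofReal (256 * π * D * h⁻¹))
  rw [← mul_assoc, ← ENNReal.ofReal_mul (by positivity),
    ← ENNReal.ofReal_mul (by positivity)] at h3
  refine le_trans (ENNReal.ofReal_le_ofReal (le_of_eq ?_)) h3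
  field_simp

end Density

lemma setLIntegral_Icc_add_right (A : ℝ → ℝ≥0∞) (h r : ℝ) :
    ∫⁻ s in Icc r (r + h), A s = ∫⁻ u in Icc 0 h, A (r + u) := by
  rw [← lintegral_indicator measurableSet_Icc, ← lintegral_indicator measurableSet_Icc,
    ← lintegral_add_left_eq_self _ r]
  refine lintegral_congr fun u => ?_
  simp [Set.indicator]

lemma measurable_sliding_window {A : ℝ → ℝ≥0∞} (hA : Measurable A) (h : ℝ) :
    Measurable fun r => ∫⁻ s in Icc r (r + h), A s := by
  simp_rw [setLIntegral_Icc_add_right]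
  exact Measurable.lintegral_prod_right' (f := fun p : ℝ × ℝ => A (p.1 + p.2)) (by fun_prop)

lemma lintegral_sliding_window_le {A : ℝ → ℝ≥0∞} (hA : Measurable A) {h R : ℝ} (hh : 0 ≤ h)
    (hR : h ≤ R) :
    ∫⁻ r in Icc h R, ∫⁻ s in Icc r (r + h), A s
      ≤ ENNReal.ofReal h * ∫⁻ s in Icc 0 (2 * R), A s := by
  simp_rw [setLIntegral_Icc_add_right]
  rw [lintegral_lintegral_swap (by fun_prop)]
  calc _ ≤ ∫⁻ _ in Icc 0 h, ∫⁻ s in Icc 0 (2 * R), A s := by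
        refine setLIntegral_mono measurable_const fun u hu => ?_
        rw [← lintegral_indicator measurableSet_Icc, ← lintegral_indicator measurableSet_Icc,
          ← lintegral_add_right_eq_self ((Icc 0 (2 * R)).indicator A) u]
        refine lintegral_mono fun r => ?_
        by_cases hr : r ∈ Icc h R
        · have hru : r + u ∈ Icc 0 (2 * R) :=
            ⟨by linarith [hr.1, hu.1], by linarith [hr.2, hu.2]⟩
          rw [Set.indicator_of_mem hr, Set.indicator_of_mem hru]
        · simp [Set.indicator_of_notMem hr]
    _ = _ := by rw [setLIntegral_const, Real.volume_Icc, sub_zero, mul_comm]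

lemma massOn_Ici_le_of_sInf_lt {d : ℕ} {g : (Fin d → ℤ) → ℂ} {c : ℝ≥0∞} {s : ℝ}
    (hne : ∃ s : ℝ, 1 ≤ s ∧ massOn g (Ici s) ≤ c)
    (hs : sInf {s : ℝ | 1 ≤ s ∧ massOn g (Ici s) ≤ c} < s) : massOn g (Ici s) ≤ c := by
  obtain ⟨s', ⟨-, hs'⟩, hlt⟩ := exists_lt_of_csInf_lt hne hs
  refine le_trans (ENNReal.tsum_le_tsum fun k => ?_) hs'
  split_ifs with h1 h2
  · exact le_rfl
  · exact absurd (hlt.le.trans h1) h2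
  · exact zero_le
  · exact le_rfl

/-- Below the dissipative scale there is a time by which mixing has completed while dissipation is
still negligible. -/
lemma exists_mixing_time {K γ ν C R s : ℝ} (hK : 1 ≤ K) (hγ : 0 < γ) (hν : 0 < ν)
    (hν1 : ν ≤ Real.exp (-1)) (hC2 : 2 ≤ C)
    (hC : 128 * π ^ 2 * ((Real.log (16 * π ^ 2 * K) + 1) / γ) ≤ C)
    (hR : R ≤ ν ^ (-(1 / 2) : ℝ) / (C * Real.sqrt (Real.log ν⁻¹))) (hs : 1 ≤ s)
    (hsR : s ≤ 2 * R) :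
    ∃ T, 0 ≤ T ∧ (2 * π * s) ^ 2 * (K * Real.exp (-γ * T)) ≤ 1 / 4 ∧
      8 * π ^ 2 * ν * s ^ 2 * T ≤ 1 / 4 := by
  have hpi := Real.pi_gt_three
  set l := Real.log ν⁻¹ with hl
  set P := (Real.log (16 * π ^ 2 * K) + 1) / γ with hP
  have hl1 : 1 ≤ l := by
    have := Real.log_le_log hν hν1
    rw [Real.log_exp] at this
    rw [hl, Real.log_inv]
    linarith
  have hs2 : s ^ 2 * (C ^ 2 * l) * ν ≤ 4 := by
    have h1 : s ^ 2 ≤ (2 * (ν ^ (-(1 / 2) : ℝ) / (C * Real.sqrt l))) ^ 2 :=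
      pow_le_pow_left₀ (by linarith) (by linarith) 2
    have h2 : (ν ^ (-(1 / 2) : ℝ)) ^ 2 = ν⁻¹ := by
      rw [← Real.rpow_natCast, ← Real.rpow_mul hν.le, ← Real.rpow_neg_one]
      norm_num
    rw [mul_pow, div_pow, mul_pow, h2, Real.sq_sqrt (by linarith)] at h1
    calc s ^ 2 * (C ^ 2 * l) * ν ≤ (2 ^ 2 * (ν⁻¹ / (C ^ 2 * l))) * (C ^ 2 * l) * ν := by gcongr
      _ = 4 := by field_simp; norm_num
  have hsν : s ^ 2 ≤ ν⁻¹ := by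
    rw [← one_div, le_div_iff₀ hν]
    have : 4 * 1 ≤ C ^ 2 * l := by
      have : (2 : ℝ) ^ 2 ≤ C ^ 2 := by gcongr
      nlinarith
    have h3 : s ^ 2 * ν * 4 ≤ s ^ 2 * ν * (C ^ 2 * l) := by gcongr; linarith
    nlinarith
  have hKpi : 1 ≤ 16 * π ^ 2 * K := by nlinarith [mul_self_nonneg π]
  have hlog : 0 ≤ Real.log (16 * π ^ 2 * K) := Real.log_nonneg hKpi
  have hB1 : 1 ≤ 16 * π ^ 2 * K * s ^ 2 := one_le_mul_of_one_le_of_one_le hKpi (one_le_pow₀ hs)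
  have hTle : Real.log (16 * π ^ 2 * K * s ^ 2) / γ ≤ P * l := by
    rw [hP, div_mul_eq_mul_div]
    gcongr
    rw [Real.log_mul (by positivity) (by positivity)]
    have : Real.log (s ^ 2) ≤ l := Real.log_le_log (by positivity) hsν
    nlinarith
  refine ⟨Real.log (16 * π ^ 2 * K * s ^ 2) / γ, div_nonneg (Real.log_nonneg hB1) hγ.le, ?_, ?_⟩
  · have : -γ * (Real.log (16 * π ^ 2 * K * s ^ 2) / γ) = -Real.log (16 * π ^ 2 * K * s ^ 2) := by
      field_simp
    rw [this, Real.exp_neg, Real.exp_log (by linarith)]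
    apply le_of_eq
    field_simp
    norm_num
  · have hP0 : 0 ≤ P := by positivity
    have h1 : 8 * π ^ 2 * ν * s ^ 2 * (Real.log (16 * π ^ 2 * K * s ^ 2) / γ)
        ≤ 8 * π ^ 2 * ν * s ^ 2 * (P * l) := by gcongr
    have h2 : 128 * π ^ 2 * P ≤ C ^ 2 := by nlinarith
    have h3 : s ^ 2 * (128 * π ^ 2 * P * l) * ν ≤ s ^ 2 * (C ^ 2 * l) * ν := by gcongr
    nlinarith

section Assembly

variable {d : ℕ} {Ω : Type*} [MeasurableSpace Ω] {ℙ : Measure Ω} [IsProbabilityMeasure ℙ]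
  {ν K γ q D : ℝ} {v : Ω → ℝ → (Fin d → ℤ) → Fin d → ℂ} {a : Ω → ℝ → (Fin d → ℤ) → ℂ}
  {g : (Fin d → ℤ) → ℂ}

/-- The total mass seen through the Cauchy kernel below the scale `2 * R` is `O(log R)`. -/
lemma AdvectionSetup.lintegral_cauchy_average_le (hs : AdvectionSetup ℙ ν K γ v a g)
    (hv : ∀ᵐ ω ∂ℙ, ∀ t : ℝ, 0 ≤ t →
        (∑' k : Fin d → ℤ, ENNReal.ofReal ((1 + znorm k) ^ q * cnorm (v ω t k)))
          ≤ ENNReal.ofReal D) (hν : 0 ≤ ν) (hq : 2 ≤ q) (hD : 0 ≤ D) (hγ : 0 < γ) (hK : 1 ≤ K)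
    {R : ℝ} (hR : 2 ≤ R) :
    ∫⁻ s in Icc 0 (2 * R), ∑' k, cauchyKernel (znorm k - s) * modeMass ℙ a k ≤
      ENNReal.ofReal
        (π * (((Real.log (64 * π ^ 2 * K) + 1) / Real.log 2 + 2) / γ * Real.log R)) := by
  have hpi := Real.pi_gt_three
  have hm : ∀ k : Fin d → ℤ, Measurable fun s => cauchyKernel (znorm k - s) := fun k => by
    have := measurable_cauchyKernel
    fun_prop
  have hpi0 : ENNReal.ofReal π ≠ 0 := (ENNReal.ofReal_pos.mpr Real.pi_pos).ne'
  set β : (Fin d → ℤ) → ℝ≥0∞ := fun k =>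
    (ENNReal.ofReal π)⁻¹ * ∫⁻ s in Icc 0 (2 * R), cauchyKernel (znorm k - s)
  have hβ : ∀ k, ENNReal.ofReal π * β k = ∫⁻ s in Icc 0 (2 * R), cauchyKernel (znorm k - s) := by
    intro k
    rw [← mul_assoc, ENNReal.mul_inv_cancel hpi0 ENNReal.ofReal_ne_top, one_mul]
  have hlow := hs.low_mass_le hv hν hq hD hγ hK (ρ := 4 * R) (by linarith) (β := β)
    (fun k => by
      rw [← ENNReal.mul_le_mul_iff_right hpi0 ENNReal.ofReal_ne_top, hβ, mul_one,
        ← lintegral_cauchyKernel_sub (znorm k)]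
      exact setLIntegral_le_lintegral _ _)
    (fun k hk => by
      rw [← ENNReal.mul_le_mul_iff_right hpi0 ENNReal.ofReal_ne_top, hβ]
      exact setLIntegral_cauchyKernel_le (by linarith) (one_le_znorm hk))
  rw [lintegral_tsum fun k => ((hm k).mul_const _).aemeasurable]
  simp_rw [lintegral_mul_const _ (hm _), ← hβ, mul_assoc (ENNReal.ofReal π), ENNReal.tsum_mul_left]
  refine (mul_le_mul_right hlow _).trans ?_
  rw [← ENNReal.ofReal_mul Real.pi_pos.le]
  refine ENNReal.ofReal_le_ofReal ?_
  rw [div_mul_eq_mul_div]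
  have hKpi : 1 ≤ 64 * π ^ 2 * K := by nlinarith [mul_self_nonneg π]
  have hlog : 0 ≤ Real.log (64 * π ^ 2 * K) := Real.log_nonneg hKpi
  have hlog2 : 0 < Real.log 2 := Real.log_pos one_lt_two
  have hlogR : Real.log 2 ≤ Real.log R := Real.log_le_log two_pos hR
  gcongr
  rw [show 4 * π ^ 2 * K * (4 * R) ^ 2 = 64 * π ^ 2 * K * R ^ 2 by ring,
    Real.log_mul (by positivity) (by positivity), Real.log_pow]
  have h1 : Real.log (64 * π ^ 2 * K) + 1
      ≤ (Real.log (64 * π ^ 2 * K) + 1) / Real.log 2 * Real.log R := by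
    rw [div_mul_eq_mul_div, le_div_iff₀ hlog2]
    gcongr
  push_cast
  linarith

/-- The logarithmic measure of the undercharged radii. -/
lemma AdvectionSetup.lintegral_undercharged_le (hs : AdvectionSetup ℙ ν K γ v a g)
    (hv : ∀ᵐ ω ∂ℙ, ∀ t : ℝ, 0 ≤ t →
        (∑' k : Fin d → ℤ, ENNReal.ofReal ((1 + znorm k) ^ q * cnorm (v ω t k)))
          ≤ ENNReal.ofReal D) (hν : 0 < ν) (hν1 : ν ≤ Real.exp (-1)) (hq : 2 ≤ q) (hD : 0 < D)
    (hγ : 0 < γ) (hK : 1 ≤ K) {N₀ C h R : ℝ} (hN : 1 ≤ N₀)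
    (hg : ∀ s, N₀ < s → massOn g (Ici s) ≤ ENNReal.ofReal (1 / 4)) (hC2 : 2 ≤ C)
    (hC1 : 128 * π ^ 2 * ((Real.log (16 * π ^ 2 * K) + 1) / γ) ≤ C) (hC3 : 256 * π ^ 2 ≤ C)
    (hh : 0 < h) (hhR : h ≤ R) (hCR : C ≤ R)
    (hR : R ≤ ν ^ (-(1 / 2) : ℝ) / (C * Real.sqrt (Real.log ν⁻¹))) :
    ∫⁻ r in {r : ℝ | h ≤ r ∧ r ≤ R ∧
        asymMass ℙ a (Icc r (r + h)) ≤ ENNReal.ofReal (h / (C * D * r))} ∩ Icc N₀ R,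
      ENNReal.ofReal r⁻¹ ≤
      ENNReal.ofReal (256 * π ^ 2 * D * (h / 4) ^ (2 - q) *
        (((Real.log (64 * π ^ 2 * K) + 1) / Real.log 2 + 2) / γ * Real.log R)) := by
  have hpi := Real.pi_pos
  set A : ℝ → ℝ≥0∞ := fun s => ∑' k, cauchyKernel (znorm k - s) * modeMass ℙ a k
  have hAm : Measurable A := measurable_cauchy_average _ _
  set c := 256 * π * D * h⁻¹ * (h / 4) ^ (2 - q) with hc
  calc _ ≤ ∫⁻ r in {r : ℝ | h ≤ r ∧ r ≤ R ∧
        asymMass ℙ a (Icc r (r + h)) ≤ ENNReal.ofReal (h / (C * D * r))} ∩ Icc N₀ R,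
          ENNReal.ofReal c * ∫⁻ s in Icc r (r + h), A s := by
        refine setLIntegral_mono ((measurable_sliding_window hAm h).const_mul _) ?_
        rintro r ⟨⟨hr1, hr2, hr3⟩, hr4, -⟩
        rw [asymMass_eq_tsum hs.1] at hr3
        refine inv_radius_le_of_undercharged _ _ hq hh hr1 hC3 hD (by convert hr3) fun s hs' => ?_
        have hNs : N₀ < s := by linarith [hs'.1]
        obtain ⟨T, hT0, hT1, hT2⟩ := exists_mixing_time hK hγ hν hν1 hC2 hC1 hR
          (by linarith : 1 ≤ s) (by linarith [hs'.2])
        exact hs.flux_lower_bound hv hν.le hq hD.le (by linarith) hT0 (hg s hNs) hT1 hT2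
    _ ≤ ∫⁻ r in Icc h R, ENNReal.ofReal c * ∫⁻ s in Icc r (r + h), A s :=
        lintegral_mono_set fun r hr => ⟨hr.1.1, hr.1.2.1⟩
    _ ≤ ENNReal.ofReal c * (ENNReal.ofReal h * ∫⁻ s in Icc 0 (2 * R), A s) := by
        rw [lintegral_const_mul _ (measurable_sliding_window hAm h)]
        gcongr
        exact lintegral_sliding_window_le hAm hh.le hhR
    _ ≤ ENNReal.ofReal c * (ENNReal.ofReal h * ENNReal.ofReal
        (π * (((Real.log (64 * π ^ 2 * K) + 1) / Real.log 2 + 2) / γ * Real.log R))) := by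
        gcongr
        exact hs.lintegral_cauchy_average_le hv hν.le hq hD.le hγ hK (hC2.trans hCR)
    _ = _ := by
        rw [← ENNReal.ofReal_mul hh.le, ← ENNReal.ofReal_mul (by positivity)]
        congr 1
        rw [hc]
        field_simp

end Assembly

/-- The choice of constants in the density bound. -/
lemma density_constant_le {P C q h D N₀ R : ℝ} (hP : 0 ≤ P) (hN : 1 ≤ N₀) (hq : 2 ≤ q)
    (hh : 0 < h) (hD : 0 ≤ D) (hR2 : 2 ≤ R) (hNR : N₀ ^ 2 ≤ R)
    (hC : 4 * (512 * π ^ 2 * P + 1) ≤ C) :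
    (Real.log (R / N₀))⁻¹ * (256 * π ^ 2 * D * (h / 4) ^ (2 - q) * (P * Real.log R))
      ≤ C ^ q * h ^ (2 - q) * D := by
  have hpi := Real.pi_pos
  have hlogR : 0 < Real.log R := Real.log_pos (by linarith)
  have hlog : Real.log R / 2 ≤ Real.log (R / N₀) := by
    have h1 : Real.log (N₀ ^ 2) ≤ Real.log R := Real.log_le_log (by positivity) hNR
    rw [Real.log_pow] at h1
    rw [Real.log_div (by positivity) (by positivity)]
    push_cast at h1
    linarith
  have h4 : (h / 4) ^ (2 - q) ≤ 4 ^ q * h ^ (2 - q) := by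
    rw [Real.div_rpow hh.le (by norm_num), div_eq_inv_mul, ← Real.rpow_neg (by norm_num)]
    gcongr
    · norm_num
    · linarith
  have hCq : 512 * π ^ 2 * P * 4 ^ q ≤ C ^ q := by
    have hC4 : 512 * π ^ 2 * P + 1 ≤ C / 4 := by linarith
    have h1 : 1 ≤ C / 4 := le_trans (by nlinarith [mul_nonneg (sq_nonneg π) hP]) hC4
    calc 512 * π ^ 2 * P * 4 ^ q ≤ (C / 4) ^ q * 4 ^ q := by
          gcongr
          calc _ ≤ (C / 4) ^ (1 : ℝ) := by rw [Real.rpow_one]; linarith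
            _ ≤ _ := Real.rpow_le_rpow_of_exponent_le h1 (by linarith)
      _ = C ^ q := by
          rw [← Real.mul_rpow (by linarith) (by norm_num)]
          congr 1
          ring
  calc _ ≤ (Real.log R / 2)⁻¹ * (256 * π ^ 2 * D * (4 ^ q * h ^ (2 - q)) * (P * Real.log R)) := by
        gcongr
    _ = 512 * π ^ 2 * P * 4 ^ q * h ^ (2 - q) * D := by
        field_simp
        ring
    _ ≤ _ := by gcongr

/-- for velocities with an a.s. weighted-ℓ¹ regularity bound of order `q`,
the logarithmic density of radii whose annulus `[r,r+h]` is undercharged is at most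
`C^q h^{2-q} D`. -/
theorem as_bounded_regularity_density_bound (d : ℕ) (hd : 1 ≤ d)
    (K γ N₀ : ℝ) (hK : 1 ≤ K) (hγ : 0 < γ) :
    ∃ C : ℝ, 2 ≤ C ∧
      ∀ (ν : ℝ), 0 < ν → ν ≤ Real.exp (-1) →
      ∀ (Ω : Type) [MeasurableSpace Ω] (ℙ : Measure Ω) [IsProbabilityMeasure ℙ]
        (v : Ω → ℝ → (Fin d → ℤ) → Fin d → ℂ) (a : Ω → ℝ → (Fin d → ℤ) → ℂ)
        (g : (Fin d → ℤ) → ℂ) (q D : ℝ), 2 ≤ q → 1 ≤ D →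
      AdvectionSetup ℙ ν K γ v a g →
      N₀ = sInf {s : ℝ | 1 ≤ s ∧ massOn g (Set.Ici s) ≤ ENNReal.ofReal (1 / 4)} →
      (∃ s : ℝ, 1 ≤ s ∧ massOn g (Set.Ici s) ≤ ENNReal.ofReal (1 / 4)) →
      (∀ᵐ ω ∂ℙ, ∀ t : ℝ, 0 ≤ t →
        (∑' k : Fin d → ℤ, ENNReal.ofReal ((1 + znorm k) ^ q * cnorm (v ω t k)))
          ≤ ENNReal.ofReal D) →
      ∀ h R : ℝ, 1 ≤ h → max C h ≤ R →
        R ≤ ν ^ (-(1 / 2) : ℝ) / (C * Real.sqrt (Real.log ν⁻¹)) →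
        logDensity N₀ R {r : ℝ | h ≤ r ∧ r ≤ R ∧
            asymMass ℙ a (Set.Icc r (r + h)) ≤ ENNReal.ofReal (h / (C * D * r))}
          ≤ ENNReal.ofReal (C ^ q * h ^ (2 - q) * D) := by
  have hpi := Real.pi_gt_three
  set P₁ := (Real.log (16 * π ^ 2 * K) + 1) / γ with hP₁
  set P₂ := ((Real.log (64 * π ^ 2 * K) + 1) / Real.log 2 + 2) / γ with hP₂
  have hKpi : 1 ≤ π ^ 2 * K := one_le_mul_of_one_le_of_one_le (by nlinarith) hK
  have hlog₁ : 0 ≤ Real.log (16 * π ^ 2 * K) := Real.log_nonneg (by linarith)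
  have hlog₂ : 0 ≤ Real.log (64 * π ^ 2 * K) := Real.log_nonneg (by linarith)
  have hlog2 : 0 < Real.log 2 := Real.log_pos one_lt_two
  have hP₁0 : 0 ≤ 128 * π ^ 2 * P₁ := by positivity
  have hP₂0 : 0 ≤ P₂ := by positivity
  have hP₂0' : 0 ≤ π ^ 2 * P₂ := by positivity
  have hpi2 : 0 ≤ π ^ 2 := by positivity
  have hN2 : 0 ≤ N₀ ^ 2 := by positivity
  refine ⟨4 * (512 * π ^ 2 * P₂ + 1) + 128 * π ^ 2 * P₁ + 256 * π ^ 2 + N₀ ^ 2 + 2, by linarith,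
    ?_⟩
  set C := 4 * (512 * π ^ 2 * P₂ + 1) + 128 * π ^ 2 * P₁ + 256 * π ^ 2 + N₀ ^ 2 + 2 with hC
  intro ν hν hν1 Ω _ ℙ _ v a g q D hq hD hs hN₀ hne hv h R hh hhR hR
  have hN : 1 ≤ N₀ := hN₀ ▸ le_csInf hne fun s hs => hs.1
  have hCR : C ≤ R := (le_max_left _ _).trans hhR
  have hint := hs.lintegral_undercharged_le hv hν hν1 hq (by linarith) hγ hK hN
    (fun s hlt => massOn_Ici_le_of_sInf_lt hne (hN₀ ▸ hlt)) (by linarith : 2 ≤ C)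
    (by linarith) (by linarith) (by linarith : 0 < h) ((le_max_right _ _).trans hhR) hCR hR
  have hlogpos : 0 < Real.log (R / N₀) := by
    refine Real.log_pos ((one_lt_div (by linarith)).mpr ?_)
    nlinarith
  rw [logDensity, ← ENNReal.ofReal_inv_of_pos hlogpos]
  refine (mul_le_mul_right hint _).trans ?_
  rw [← ENNReal.ofReal_mul (inv_nonneg.mpr hlogpos.le)]
  exact ENNReal.ofReal_le_ofReal (density_constant_le hP₂0 hN hq (by linarith) (by linarith)
    (by linarith) (by linarith) (by linarith))
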